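/- (Complete characterization, positive direction.) Let n ∈ ℕ and let V ⊆ {0,…,n−1} be admissible with |V| = m ≥ 2, and let M = {0,…,n−1} \ V. Then there exists a basis assignment b : M → {x,y,z} such that for every outcome string s : M → Fin 2 and every choice of unit eigenvectors χ_j of σ_{b(j)} with eigenvalue (−1)^{s(j)}, there exist 2×2 Clifford unitaries U_0, …, U_{m−1} and a scalar c ∈ ℂ with c ≠ 0 satisfying (⨂_i U_i) φ = c · GHZ_m, where φ is the post-measurement state determined by M, b, s and the χ_j. -/

import Mathlib

noncomputable section

/-- The `j`-th bit of a bit string `v : Fin k → Fin 2`, with out-of-range indices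
giving `0`. -/
def bitAt (k : ℕ) (v : Fin k → Fin 2) (j : ℕ) : Fin 2 :=
  if h : j < k then v ⟨j, h⟩ else 0

/-- The `n`-qubit linear cluster state:
`L_n(v) = (√2)^{−n} · (−1)^{Σ_{i=0}^{n−2} v_i·v_{i+1}}`. -/
def linCluster (n : ℕ) : (Fin n → Fin 2) → ℂ := fun v =>
  ((Real.sqrt 2 : ℂ))⁻¹ ^ n *
    (-1 : ℂ) ^ (∑ i ∈ Finset.range (n - 1), (bitAt n v i : ℕ) * (bitAt n v (i + 1) : ℕ))

/-- The `m`-qubit GHZ state: `GHZ_m(w) = (√2)^{−1}` if `w` is constant, `0` otherwise. -/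
def ghzState (m : ℕ) : (Fin m → Fin 2) → ℂ := fun w =>
  if ∀ i j : Fin m, w i = w j then ((Real.sqrt 2 : ℂ))⁻¹ else 0

/-- The Pauli matrix `σ_x`. -/
def sigmaX : Matrix (Fin 2) (Fin 2) ℂ := !![0, 1; 1, 0]

/-- The Pauli matrix `σ_y`. -/
def sigmaY : Matrix (Fin 2) (Fin 2) ℂ := !![0, -Complex.I; Complex.I, 0]

/-- The Pauli matrix `σ_z`. -/
def sigmaZ : Matrix (Fin 2) (Fin 2) ℂ := !![1, 0; 0, -1]

/-- The Hadamard matrix `(1/√2)·!![1,1;1,−1]`. -/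
def hadamard : Matrix (Fin 2) (Fin 2) ℂ := ((Real.sqrt 2 : ℂ))⁻¹ • !![1, 1; 1, -1]

/-- A measurement basis label: `x`, `y` or `z`. -/
inductive PauliBasis | x | y | z

/-- The Pauli matrix corresponding to a basis label. -/
def pauliOf : PauliBasis → Matrix (Fin 2) (Fin 2) ℂ
  | .x => sigmaX
  | .y => sigmaY
  | .z => sigmaZ

/-- The (unnormalized) post-measurement state on the unmeasured qubits: for a target
bit string `w : Fin m → Fin 2`,
`φ(w) = Σ_{v : Fin n → Fin 2, v ∘ ι = w} (∏_{j∈M} conj(χ_j(v(j)))) · L_n(v)`,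
where `ι` is the enumeration of the unmeasured qubits and `χ_j` the post-measurement
single-qubit states on the measured qubits `j ∈ M`. -/
def postMeas (n m : ℕ) (M : Finset ℕ) (ι : Fin m → ℕ) (χ : ℕ → Fin 2 → ℂ) :
    (Fin m → Fin 2) → ℂ := fun w =>
  ∑ v ∈ Finset.univ.filter (fun v : Fin n → Fin 2 => ∀ i : Fin m, bitAt n v (ι i) = w i),
    (∏ j ∈ M, (starRingEnd ℂ) (χ j (bitAt n v j))) * linCluster n v

/-- The action of a tensor product `⨂_i U_i` of single-qubit operators on an `m`-qubit
state vector: `((⨂_i U_i)ψ)(w) = Σ_{w'} (∏_i U_i(w(i), w'(i))) · ψ(w')`. -/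
def localApply (m : ℕ) (U : Fin m → Matrix (Fin 2) (Fin 2) ℂ)
    (ψ : (Fin m → Fin 2) → ℂ) : (Fin m → Fin 2) → ℂ := fun w =>
  ∑ w' : Fin m → Fin 2, (∏ i : Fin m, U i (w i) (w' i)) * ψ w'

/-- A `2×2` matrix is a Clifford unitary if it is unitary and conjugates each of
`σ_x, σ_z` into `{±1, ±i} · {1, σ_x, σ_y, σ_z}`. -/
def IsClifford (U : Matrix (Fin 2) (Fin 2) ℂ) : Prop :=
  U ∈ Matrix.unitaryGroup (Fin 2) ℂ ∧
  ∀ P ∈ ({sigmaX, sigmaZ} : Set (Matrix (Fin 2) (Fin 2) ℂ)),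
    ∃ c ∈ ({1, -1, Complex.I, -Complex.I} : Set ℂ),
      ∃ Q ∈ ({1, sigmaX, sigmaY, sigmaZ} : Set (Matrix (Fin 2) (Fin 2) ℂ)),
        U * P * U⁻¹ = c • Q


/-- A finite set `V ⊆ {0, 1, …, n−1}` is *admissible* if every pair of consecutive
elements of `V` has no element of `V` strictly to its left or no element of `V`
strictly to its right. -/
def Admissible (n : ℕ) (V : Finset ℕ) : Prop :=
  V ⊆ Finset.range n ∧
  ∀ i : ℕ, i ∈ V → i + 1 ∈ V → (∀ j ∈ V, i ≤ j) ∨ (∀ j ∈ V, j ≤ i + 1)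

/-! ### Single-qubit Clifford matrices -/

/-- The phase gate `diag(1, i)`. -/
def phaseGate : Matrix (Fin 2) (Fin 2) ℂ := !![1, 0; 0, Complex.I]

/-- The unnormalized Hadamard matrix, with entries `(-1)^(a·b)`. -/
def walsh : Matrix (Fin 2) (Fin 2) ℂ := !![1, 1; 1, -1]

lemma sigmaX_mul_self : sigmaX * sigmaX = 1 := by
  ext a b; fin_cases a <;> fin_cases b <;> simp [sigmaX, Matrix.mul_apply]

lemma phaseGate_pow (p : ℕ) : phaseGate ^ p = !![1, 0; 0, Complex.I ^ p] := by
  induction p with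
  | zero => ext a b; fin_cases a <;> fin_cases b <;> simp
  | succ p ih =>
    rw [pow_succ, ih]
    ext a b; fin_cases a <;> fin_cases b <;> simp [phaseGate, Matrix.mul_apply, pow_succ]

lemma walsh_mul_self : walsh * walsh = (2 : ℂ) • 1 := by
  ext a b; fin_cases a <;> fin_cases b <;> norm_num [walsh, Matrix.mul_apply]

lemma walsh_apply (a b : Fin 2) : walsh a b = (-1 : ℂ) ^ ((a : ℕ) * (b : ℕ)) := by
  fin_cases a <;> fin_cases b <;> simp [walsh]

lemma sigmaX_mul_walsh : sigmaX * walsh = walsh * phaseGate ^ 2 := by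
  rw [phaseGate_pow]
  ext a b; fin_cases a <;> fin_cases b <;> simp [walsh, sigmaX, Matrix.mul_apply]

lemma walsh_mul_phaseGate_pow_even_mul_walsh {q : ℕ} (hq : Even q) :
    ∃ P : Matrix (Fin 2) (Fin 2) ℂ, (P = 1 ∨ P = sigmaX) ∧
      walsh * phaseGate ^ q * walsh = (2 : ℂ) • P := by
  obtain ⟨k, rfl⟩ := hq
  have hI : Complex.I ^ (k + k) = (-1) ^ k := by
    rw [← two_mul, pow_mul, Complex.I_sq]
  rcases neg_one_pow_eq_or ℂ k with h | h
  · refine ⟨1, Or.inl rfl, ?_⟩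
    rw [phaseGate_pow, hI, h]
    ext a b; fin_cases a <;> fin_cases b <;> norm_num [walsh, Matrix.mul_apply]
  · refine ⟨sigmaX, Or.inr rfl, ?_⟩
    rw [phaseGate_pow, hI, h]
    ext a b; fin_cases a <;> fin_cases b <;> norm_num [walsh, sigmaX, Matrix.mul_apply]

lemma walsh_mul_phaseGate_pow_odd_mul_walsh {q : ℕ} (hq : ¬ Even q) :
    ∃ c : ℂ, c ≠ 0 ∧ walsh * phaseGate ^ q * walsh =
      c • (phaseGate ^ (3 * q) * walsh * phaseGate ^ (3 * q)) := by
  obtain ⟨k, rfl⟩ := Nat.not_even_iff_odd.mp hq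
  have hI : Complex.I ^ (2 * k + 1) = (-1) ^ k * Complex.I := by
    rw [pow_succ, pow_mul, Complex.I_sq]
  have hI3 : Complex.I ^ (3 * (2 * k + 1)) = -((-1) ^ k * Complex.I) := by
    have : ((-1 : ℂ) ^ k) ^ 3 = (-1) ^ k := by
      rcases neg_one_pow_eq_or ℂ k with h | h <;> rw [h] <;> norm_num
    rw [mul_comm 3, pow_mul, hI, mul_pow, this, Complex.I_pow_three]; ring
  refine ⟨1 + (-1) ^ k * Complex.I, ?_, ?_⟩
  · intro h
    have := congrArg Complex.re h
    rcases neg_one_pow_eq_or ℂ k with h' | h' <;> simp [h'] at this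
  · rw [phaseGate_pow, phaseGate_pow, hI, hI3]
    have hI2 := Complex.I_mul_I
    rcases neg_one_pow_eq_or ℂ k with h' | h' <;> rw [h'] <;> ext a b <;>
      fin_cases a <;> fin_cases b <;> simp [walsh, Matrix.mul_apply] <;>
      first | ring1 | linear_combination hI2

lemma IsClifford.mul_inv_self {U : Matrix (Fin 2) (Fin 2) ℂ} (hU : IsClifford U) :
    U * U⁻¹ = 1 := by
  have h := Matrix.mem_unitaryGroup_iff.mp hU.1
  rwa [Matrix.inv_eq_right_inv h]

lemma IsClifford.inv_mul_self {U : Matrix (Fin 2) (Fin 2) ℂ} (hU : IsClifford U) :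
    U⁻¹ * U = 1 :=
  mul_eq_one_comm.mp hU.mul_inv_self

lemma pauli_mul_pauli {P Q : Matrix (Fin 2) (Fin 2) ℂ}
    (hP : P ∈ ({1, sigmaX, sigmaY, sigmaZ} : Set (Matrix (Fin 2) (Fin 2) ℂ)))
    (hQ : Q ∈ ({1, sigmaX, sigmaY, sigmaZ} : Set (Matrix (Fin 2) (Fin 2) ℂ))) :
    ∃ c ∈ ({1, -1, Complex.I, -Complex.I} : Set ℂ),
      ∃ R ∈ ({1, sigmaX, sigmaY, sigmaZ} : Set (Matrix (Fin 2) (Fin 2) ℂ)), P * Q = c • R := by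
  have hXZ : sigmaX * sigmaZ = (-Complex.I) • sigmaY := by
    ext a b; fin_cases a <;> fin_cases b <;> simp [sigmaX, sigmaY, sigmaZ, Matrix.mul_apply]
  have hZX : sigmaZ * sigmaX = Complex.I • sigmaY := by
    ext a b; fin_cases a <;> fin_cases b <;> simp [sigmaX, sigmaY, sigmaZ, Matrix.mul_apply]
  have hXY : sigmaX * sigmaY = Complex.I • sigmaZ := by
    ext a b; fin_cases a <;> fin_cases b <;> simp [sigmaX, sigmaY, sigmaZ, Matrix.mul_apply]
  have hYX : sigmaY * sigmaX = (-Complex.I) • sigmaZ := by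
    ext a b; fin_cases a <;> fin_cases b <;> simp [sigmaX, sigmaY, sigmaZ, Matrix.mul_apply]
  have hYZ : sigmaY * sigmaZ = Complex.I • sigmaX := by
    ext a b; fin_cases a <;> fin_cases b <;> simp [sigmaX, sigmaY, sigmaZ, Matrix.mul_apply]
  have hZY : sigmaZ * sigmaY = (-Complex.I) • sigmaX := by
    ext a b; fin_cases a <;> fin_cases b <;> simp [sigmaX, sigmaY, sigmaZ, Matrix.mul_apply]
  have hYY : sigmaY * sigmaY = 1 := by
    ext a b; fin_cases a <;> fin_cases b <;> simp [sigmaY, Matrix.mul_apply]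
  have hZZ : sigmaZ * sigmaZ = 1 := by
    ext a b; fin_cases a <;> fin_cases b <;> simp [sigmaZ, Matrix.mul_apply]
  have hX := sigmaX_mul_self
  have one_smul' (R : Matrix (Fin 2) (Fin 2) ℂ) : R = (1 : ℂ) • R := (one_smul _ _).symm
  rcases hP with rfl | rfl | rfl | rfl
  · exact ⟨1, by simp, Q, hQ, (one_mul _).trans (one_smul' _)⟩
  · rcases hQ with rfl | rfl | rfl | rfl
    · exact ⟨1, by simp, _, by simp, (mul_one _).trans (one_smul' _)⟩
    · exact ⟨1, by simp, _, by simp, hX.trans (one_smul' _)⟩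
    · exact ⟨Complex.I, by simp, _, by simp, hXY⟩
    · exact ⟨-Complex.I, by simp, _, by simp, hXZ⟩
  · rcases hQ with rfl | rfl | rfl | rfl
    · exact ⟨1, by simp, _, by simp, (mul_one _).trans (one_smul' _)⟩
    · exact ⟨-Complex.I, by simp, _, by simp, hYX⟩
    · exact ⟨1, by simp, _, by simp, hYY.trans (one_smul' _)⟩
    · exact ⟨Complex.I, by simp, _, by simp, hYZ⟩
  · rcases hQ with rfl | rfl | rfl | rfl
    · exact ⟨1, by simp, _, by simp, (mul_one _).trans (one_smul' _)⟩
    · exact ⟨Complex.I, by simp, _, by simp, hZX⟩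
    · exact ⟨-Complex.I, by simp, _, by simp, hZY⟩
    · exact ⟨1, by simp, _, by simp, hZZ.trans (one_smul' _)⟩

lemma phase_mul_phase {c d : ℂ} (hc : c ∈ ({1, -1, Complex.I, -Complex.I} : Set ℂ))
    (hd : d ∈ ({1, -1, Complex.I, -Complex.I} : Set ℂ)) :
    c * d ∈ ({1, -1, Complex.I, -Complex.I} : Set ℂ) := by
  simp only [Set.mem_insert_iff, Set.mem_singleton_iff] at hc hd ⊢
  rcases hc with rfl | rfl | rfl | rfl <;> rcases hd with rfl | rfl | rfl | rfl <;> simp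

lemma IsClifford.conj_pauli {U : Matrix (Fin 2) (Fin 2) ℂ} (hU : IsClifford U)
    {P : Matrix (Fin 2) (Fin 2) ℂ}
    (hP : P ∈ ({1, sigmaX, sigmaY, sigmaZ} : Set (Matrix (Fin 2) (Fin 2) ℂ))) :
    ∃ c ∈ ({1, -1, Complex.I, -Complex.I} : Set ℂ),
      ∃ Q ∈ ({1, sigmaX, sigmaY, sigmaZ} : Set (Matrix (Fin 2) (Fin 2) ℂ)),
        U * P * U⁻¹ = c • Q := by
  rcases hP with rfl | rfl | rfl | rfl
  · exact ⟨1, by simp, 1, by simp, by rw [mul_one, hU.mul_inv_self, one_smul]⟩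
  · exact hU.2 _ (by simp)
  · obtain ⟨c, hc, Q, hQ, h⟩ := hU.2 sigmaX (by simp)
    obtain ⟨d, hd, R, hR, h'⟩ := hU.2 sigmaZ (by simp)
    obtain ⟨e, he, T, hT, h''⟩ := pauli_mul_pauli hQ hR
    have hY : sigmaY = Complex.I • (sigmaX * sigmaZ) := by
      ext a b; fin_cases a <;> fin_cases b <;> simp [sigmaX, sigmaY, sigmaZ]
    refine ⟨Complex.I * (c * d * e), phase_mul_phase (by simp)
      (phase_mul_phase (phase_mul_phase hc hd) he), T, hT, ?_⟩
    have hconj : U * (sigmaX * sigmaZ) * U⁻¹ = (U * sigmaX * U⁻¹) * (U * sigmaZ * U⁻¹) := by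
      rw [show (U * sigmaX * U⁻¹) * (U * sigmaZ * U⁻¹) =
        U * sigmaX * (U⁻¹ * U) * sigmaZ * U⁻¹ by simp only [Matrix.mul_assoc], hU.inv_mul_self]
      simp only [mul_one, Matrix.mul_assoc]
    rw [hY, Matrix.mul_smul, Matrix.smul_mul, hconj, h, h', Matrix.smul_mul, Matrix.mul_smul, h'']
    simp only [smul_smul, mul_assoc]
  · exact hU.2 _ (by simp)

lemma IsClifford.mul {U V : Matrix (Fin 2) (Fin 2) ℂ} (hU : IsClifford U) (hV : IsClifford V) :
    IsClifford (U * V) := by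
  refine ⟨mul_mem hU.1 hV.1, fun P hP => ?_⟩
  obtain ⟨c, hc, Q, hQ, h⟩ := hV.2 P hP
  obtain ⟨d, hd, R, hR, h'⟩ := hU.conj_pauli hQ
  refine ⟨c * d, phase_mul_phase hc hd, R, hR, ?_⟩
  rw [Matrix.mul_inv_rev, show U * V * P * (V⁻¹ * U⁻¹) = U * (V * P * V⁻¹) * U⁻¹ by
    simp only [Matrix.mul_assoc], h, Matrix.mul_smul, Matrix.smul_mul, h', smul_smul]

lemma isClifford_of_mul_eq {U W : Matrix (Fin 2) (Fin 2) ℂ} (hW : star U = W) (h : U * W = 1)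
    (h' : ∀ P ∈ ({sigmaX, sigmaZ} : Set (Matrix (Fin 2) (Fin 2) ℂ)),
      ∃ Q ∈ ({1, sigmaX, sigmaY, sigmaZ} : Set (Matrix (Fin 2) (Fin 2) ℂ)),
        U * P * W = Q ∨ U * P * W = -Q) : IsClifford U := by
  refine ⟨Matrix.mem_unitaryGroup_iff.mpr (hW ▸ h), fun P hP => ?_⟩
  obtain ⟨Q, hQ, hQ'⟩ := h' P hP
  rw [Matrix.inv_eq_right_inv h]
  rcases hQ' with e | e
  · exact ⟨1, by simp, Q, hQ, by rw [e, one_smul]⟩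
  · exact ⟨-1, by simp, Q, hQ, by rw [e, neg_one_smul]⟩

lemma isClifford_one : IsClifford 1 :=
  isClifford_of_mul_eq (star_one _) (one_mul 1) fun P hP => ⟨P, by
    rcases hP with rfl | rfl <;> simp, Or.inl (by simp)⟩

lemma isClifford_sigmaX : IsClifford sigmaX := by
  refine isClifford_of_mul_eq (W := sigmaX) ?_ sigmaX_mul_self fun P hP => ⟨P, ?_, ?_⟩
  · ext a b; fin_cases a <;> fin_cases b <;> simp [sigmaX]
  · rcases hP with rfl | rfl <;> simp
  · rcases hP with rfl | rfl
    · left; rw [sigmaX_mul_self, one_mul]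
    · right; ext a b; fin_cases a <;> fin_cases b <;> simp [sigmaX, sigmaZ, Matrix.mul_apply]

lemma isClifford_phaseGate : IsClifford phaseGate := by
  refine isClifford_of_mul_eq (W := !![1, 0; 0, -Complex.I]) ?_ ?_ fun P hP => ?_
  · ext a b; fin_cases a <;> fin_cases b <;> simp [phaseGate]
  · ext a b; fin_cases a <;> fin_cases b <;> simp [phaseGate]
  · rcases hP with rfl | rfl
    · refine ⟨sigmaY, by simp, Or.inl ?_⟩
      ext a b; fin_cases a <;> fin_cases b <;> simp [phaseGate, sigmaX, sigmaY, Matrix.mul_apply]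
    · refine ⟨sigmaZ, by simp, Or.inl ?_⟩
      ext a b; fin_cases a <;> fin_cases b <;> simp [phaseGate, sigmaZ, Matrix.mul_apply]

lemma hadamard_eq_smul_walsh : hadamard = ((Real.sqrt 2 : ℂ))⁻¹ • walsh := rfl

lemma inv_sqrt_two_mul_self : ((Real.sqrt 2 : ℂ))⁻¹ * ((Real.sqrt 2 : ℂ))⁻¹ = 2⁻¹ := by
  rw [← mul_inv, ← Complex.ofReal_mul, Real.mul_self_sqrt (by norm_num)]; simp

lemma sqrt_two_ne_zero : ((Real.sqrt 2 : ℝ) : ℂ) ≠ 0 := by simp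

lemma isClifford_hadamard : IsClifford hadamard := by
  have hconj (P : Matrix (Fin 2) (Fin 2) ℂ) :
      hadamard * P * hadamard = (2⁻¹ : ℂ) • (walsh * P * walsh) := by
    simp only [hadamard_eq_smul_walsh, Matrix.smul_mul, Matrix.mul_smul, smul_smul,
      inv_sqrt_two_mul_self]
  refine isClifford_of_mul_eq (W := hadamard) ?_ ?_ fun P hP => ?_
  · ext a b; fin_cases a <;> fin_cases b <;> simp [hadamard]
  · have := hconj 1
    rw [mul_one, mul_one, walsh_mul_self, smul_smul] at this
    rw [this]; norm_num
  · rcases hP with rfl | rfl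
    · refine ⟨sigmaZ, by simp, Or.inl ?_⟩
      rw [hconj]
      ext a b; fin_cases a <;> fin_cases b <;> norm_num [walsh, sigmaX, sigmaZ, Matrix.mul_apply]
    · refine ⟨sigmaX, by simp, Or.inl ?_⟩
      rw [hconj]
      ext a b; fin_cases a <;> fin_cases b <;> norm_num [walsh, sigmaX, sigmaZ, Matrix.mul_apply]

/-- A matrix that some Clifford unitary inverts up to a nonzero scalar. -/
def IsScaledClifford (A : Matrix (Fin 2) (Fin 2) ℂ) : Prop :=
  ∃ U, IsClifford U ∧ ∃ c : ℂ, c ≠ 0 ∧ U * A = c • 1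

namespace IsScaledClifford

lemma mul {A B : Matrix (Fin 2) (Fin 2) ℂ} (hA : IsScaledClifford A) (hB : IsScaledClifford B) :
    IsScaledClifford (A * B) := by
  obtain ⟨U, hU, c, hc, h⟩ := hA
  obtain ⟨W, hW, d, hd, h'⟩ := hB
  refine ⟨W * U, hW.mul hU, c * d, mul_ne_zero hc hd, ?_⟩
  rw [show W * U * (A * B) = W * (U * A) * B by simp only [Matrix.mul_assoc], h, Matrix.mul_smul,
    Matrix.smul_mul, mul_one, h', smul_smul]

lemma smul {A : Matrix (Fin 2) (Fin 2) ℂ} (hA : IsScaledClifford A) {c : ℂ} (hc : c ≠ 0) :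
    IsScaledClifford (c • A) := by
  obtain ⟨U, hU, d, hd, h⟩ := hA
  exact ⟨U, hU, c * d, mul_ne_zero hc hd, by rw [Matrix.mul_smul, h, smul_smul]⟩

protected lemma one : IsScaledClifford 1 :=
  ⟨1, isClifford_one, 1, one_ne_zero, by simp⟩

protected lemma sigmaX : IsScaledClifford sigmaX :=
  ⟨_, isClifford_sigmaX, 1, one_ne_zero, by rw [sigmaX_mul_self, one_smul]⟩

protected lemma walsh : IsScaledClifford walsh := by
  refine ⟨_, isClifford_hadamard, ((Real.sqrt 2 : ℂ))⁻¹ * 2,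
    mul_ne_zero (inv_ne_zero sqrt_two_ne_zero) two_ne_zero, ?_⟩
  rw [hadamard_eq_smul_walsh, Matrix.smul_mul, walsh_mul_self, smul_smul]

protected lemma phaseGate : IsScaledClifford phaseGate := by
  refine ⟨phaseGate * (phaseGate * phaseGate), isClifford_phaseGate.mul
    (isClifford_phaseGate.mul isClifford_phaseGate), 1, one_ne_zero, ?_⟩
  rw [show phaseGate * (phaseGate * phaseGate) * phaseGate = phaseGate ^ 4 by
    simp only [pow_succ, pow_zero, one_mul, Matrix.mul_assoc], phaseGate_pow, Complex.I_pow_four]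
  ext a b; fin_cases a <;> fin_cases b <;> simp

lemma phaseGate_pow (p : ℕ) : IsScaledClifford (phaseGate ^ p) := by
  induction p with
  | zero => simpa using IsScaledClifford.one
  | succ p ih => rw [pow_succ]; exact ih.mul .phaseGate

end IsScaledClifford

/-! ### Eigenvectors of the Pauli matrices -/

lemma sigmaZ_eigenvector {χ : Fin 2 → ℂ} {s : Fin 2} (h1 : ∑ a : Fin 2, ‖χ a‖ ^ 2 = 1)
    (h : sigmaZ.mulVec χ = ((-1 : ℂ) ^ (s : ℕ)) • χ) :
    ∃ d : ℂ, d ≠ 0 ∧ ∀ a, (starRingEnd ℂ) (χ a) = if a = s then d else 0 := by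
  have e0 := congrFun h 0
  have e1 := congrFun h 1
  fin_cases s <;> simp [sigmaZ, Matrix.mulVec, dotProduct] at e0 e1 h1
  · have : χ 1 = 0 := by linear_combination (-1 / 2 : ℂ) * e1
    refine ⟨(starRingEnd ℂ) (χ 0), ?_, fun a => by fin_cases a <;> simp [this]⟩
    intro h0
    simp [this, (map_eq_zero _).mp h0] at h1
  · have : χ 0 = 0 := by linear_combination (1 / 2 : ℂ) * e0
    refine ⟨(starRingEnd ℂ) (χ 1), ?_, fun a => by fin_cases a <;> simp [this]⟩
    intro h0
    simp [this, (map_eq_zero _).mp h0] at h1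

lemma exists_conj_eq_mul_I_pow {χ : Fin 2 → ℂ} (r : ℕ) (h1 : ∑ a : Fin 2, ‖χ a‖ ^ 2 = 1)
    (h : (starRingEnd ℂ) (χ 1) = (starRingEnd ℂ) (χ 0) * Complex.I ^ r) :
    ∃ d : ℂ, d ≠ 0 ∧ ∀ a : Fin 2, (starRingEnd ℂ) (χ a) = d * Complex.I ^ (r * (a : ℕ)) := by
  refine ⟨(starRingEnd ℂ) (χ 0), ?_, fun a => by fin_cases a <;> simp [h]⟩
  intro h0
  rw [h0, zero_mul] at h
  simp [(map_eq_zero _).mp h0, (map_eq_zero _).mp h] at h1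

lemma sigmaX_eigenvector {χ : Fin 2 → ℂ} {s : Fin 2} (h1 : ∑ a : Fin 2, ‖χ a‖ ^ 2 = 1)
    (h : sigmaX.mulVec χ = ((-1 : ℂ) ^ (s : ℕ)) • χ) :
    ∃ (r : ℕ) (d : ℂ), Even r ∧ d ≠ 0 ∧
      ∀ a : Fin 2, (starRingEnd ℂ) (χ a) = d * Complex.I ^ (r * (a : ℕ)) := by
  have e0 := congrFun h 0
  have key : (starRingEnd ℂ) (χ 1) = (starRingEnd ℂ) (χ 0) * Complex.I ^ (2 * (s : ℕ)) := by
    rw [pow_mul, Complex.I_sq]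
    fin_cases s <;> simp [sigmaX, Matrix.mulVec, dotProduct] at e0 <;> simp [e0]
  obtain ⟨d, hd, h'⟩ := exists_conj_eq_mul_I_pow _ h1 key
  exact ⟨_, d, even_two_mul _, hd, h'⟩

lemma sigmaY_eigenvector {χ : Fin 2 → ℂ} {s : Fin 2} (h1 : ∑ a : Fin 2, ‖χ a‖ ^ 2 = 1)
    (h : sigmaY.mulVec χ = ((-1 : ℂ) ^ (s : ℕ)) • χ) :
    ∃ (r : ℕ) (d : ℂ), ¬ Even r ∧ d ≠ 0 ∧
      ∀ a : Fin 2, (starRingEnd ℂ) (χ a) = d * Complex.I ^ (r * (a : ℕ)) := by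
  have e1 := congrFun h 1
  have key : (starRingEnd ℂ) (χ 1) = (starRingEnd ℂ) (χ 0) * Complex.I ^ (2 * (s : ℕ) + 3) := by
    rw [pow_add, pow_mul, Complex.I_sq, Complex.I_pow_three]
    fin_cases s <;> simp [sigmaY, Matrix.mulVec, dotProduct] at e1
    · simp [← e1, mul_comm]
    · have e2 : χ 1 = -(Complex.I * χ 0) := by rw [e1, neg_neg]
      simp [e2, mul_comm]
  obtain ⟨d, hd, h'⟩ := exists_conj_eq_mul_I_pow _ h1 key
  exact ⟨_, d, by simp [parity_simps], hd, h'⟩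

/-! ### Scanning the cluster state from left to right -/

/-- The row vector obtained by contracting the first `j` sites of the cluster chain with the
single-site weights `p`; its index is the bit of the last contracted site. -/
def chainVec (p : ℕ → Fin 2 → ℂ) : ℕ → Fin 2 → ℂ
  | 0 => fun a => if a = 0 then 1 else 0
  | j + 1 => fun b => p j b * ∑ a, chainVec p j a * walsh a b

lemma chainVec_succ (p : ℕ → Fin 2 → ℂ) (j : ℕ) (b : Fin 2) :
    chainVec p (j + 1) b = p j b * ∑ a, chainVec p j a * walsh a b := rfl

lemma bitAt_snoc_of_lt {n j : ℕ} (hj : j < n) (v : Fin n → Fin 2) (b : Fin 2) :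
    bitAt (n + 1) (Fin.snoc v b) j = bitAt n v j := by
  rw [bitAt, bitAt, dif_pos (hj.trans n.lt_succ_self), dif_pos hj]
  exact Fin.snoc_castSucc (α := fun _ => Fin 2) b v ⟨j, hj⟩

lemma bitAt_snoc_self {n : ℕ} (v : Fin n → Fin 2) (b : Fin 2) :
    bitAt (n + 1) (Fin.snoc v b) n = b := by
  rw [bitAt, dif_pos n.lt_succ_self]
  exact Fin.snoc_last (α := fun _ => Fin 2) b v

lemma neg_one_pow_sum_bitAt_snoc {n : ℕ} (v : Fin n → Fin 2) (b : Fin 2) :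
    (-1 : ℂ) ^ (∑ i ∈ Finset.range n, (bitAt (n + 1) (Fin.snoc v b) i : ℕ) *
        (bitAt (n + 1) (Fin.snoc v b) (i + 1) : ℕ)) =
      (-1 : ℂ) ^ (∑ i ∈ Finset.range (n - 1), (bitAt n v i : ℕ) * (bitAt n v (i + 1) : ℕ)) *
        walsh (bitAt n v (n - 1)) b := by
  rw [walsh_apply, ← pow_add]
  congr 1
  cases n with
  | zero => simp [bitAt]
  | succ n =>
    rw [Finset.sum_range_succ, bitAt_snoc_self, bitAt_snoc_of_lt n.lt_succ_self,
      Nat.add_sub_cancel]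
    congr 1
    refine Finset.sum_congr rfl fun i hi => ?_
    have := Finset.mem_range.mp hi
    rw [bitAt_snoc_of_lt (by lia), bitAt_snoc_of_lt (by lia)]

lemma sum_prod_mul_sign_eq_sum_chainVec (p : ℕ → Fin 2 → ℂ) (n : ℕ) (g : Fin 2 → ℂ) :
    ∑ v : Fin n → Fin 2, (∏ j ∈ Finset.range n, p j (bitAt n v j)) *
        (-1 : ℂ) ^ (∑ i ∈ Finset.range (n - 1), (bitAt n v i : ℕ) * (bitAt n v (i + 1) : ℕ)) *
        g (bitAt n v (n - 1)) = ∑ b, chainVec p n b * g b := by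
  induction n generalizing g with
  | zero => simp [chainVec, bitAt]
  | succ n ih =>
    rw [← (Fin.snocEquiv fun _ => Fin 2).sum_comp, Fintype.sum_prod_type]
    refine Finset.sum_congr rfl fun b _ => ?_
    have h := ih fun a => walsh a b
    rw [chainVec_succ, ← h, Finset.mul_sum, Finset.sum_mul]
    refine Finset.sum_congr rfl fun v _ => ?_
    simp only [Fin.snocEquiv, Equiv.coe_fn_mk, Nat.add_sub_cancel]
    rw [neg_one_pow_sum_bitAt_snoc, Finset.prod_range_succ, bitAt_snoc_self,
      Finset.prod_congr rfl fun j hj => by rw [bitAt_snoc_of_lt (Finset.mem_range.mp hj)]]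
    ring

/-! ### Local Clifford equivalence with the GHZ state -/

lemma exists_localApply_eq_smul_ghzState {m : ℕ} (hm : 0 < m)
    (A : Fin m → Matrix (Fin 2) (Fin 2) ℂ) (hA : ∀ i, IsScaledClifford (A i)) {κ : ℂ}
    (hκ : κ ≠ 0) {φ : (Fin m → Fin 2) → ℂ} (hφ : ∀ w, φ w = κ * ∑ t, ∏ i, A i (w i) t) :
    ∃ U : Fin m → Matrix (Fin 2) (Fin 2) ℂ, (∀ i, IsClifford (U i)) ∧
      ∃ c : ℂ, c ≠ 0 ∧ localApply m U φ = c • ghzState m := by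
  choose U hU d hd hUA using hA
  refine ⟨U, hU, κ * (∏ i, d i) * (Real.sqrt 2 : ℂ), mul_ne_zero (mul_ne_zero hκ
    (Finset.prod_ne_zero_iff.mpr fun i _ => hd i)) sqrt_two_ne_zero, ?_⟩
  funext w
  have hprod (t : Fin 2) : ∑ w' : Fin m → Fin 2, ∏ i, (U i (w i) (w' i) * A i (w' i) t) =
      (∏ i, d i) * if ∀ i, w i = t then 1 else 0 := by
    rw [← Fintype.piFinset_univ, ← Finset.prod_univ_sum (fun _ => Finset.univ)
      fun i x => U i (w i) x * A i x t]
    have (i : Fin m) : ∑ x, U i (w i) x * A i x t = d i * if w i = t then 1 else 0 := by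
      rw [← Matrix.mul_apply, hUA, Matrix.smul_apply, Matrix.one_apply, smul_eq_mul]
    simp_rw [this, Finset.prod_mul_distrib]
    congr 1
    rw [Finset.prod_ite_zero]
    simp
  have hsum : ∑ t : Fin 2, (if ∀ i, w i = t then 1 else 0 : ℂ) =
      if ∀ i j, w i = w j then 1 else 0 := by
    split_ifs with h
    · rw [Finset.sum_eq_single_of_mem (w ⟨0, hm⟩) (Finset.mem_univ _)]
      · rw [if_pos fun i => h i _]
      · exact fun t _ ht => if_neg fun h' => ht (h' ⟨0, hm⟩).symm
    · exact Finset.sum_eq_zero fun t _ => if_neg fun h' => h fun i j => (h' i).trans (h' j).symm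
  calc localApply m U φ w
      = κ * ∑ t, ∑ w' : Fin m → Fin 2, ∏ i, (U i (w i) (w' i) * A i (w' i) t) := by
        rw [Finset.sum_comm, Finset.mul_sum]
        refine Finset.sum_congr rfl fun w' _ => ?_
        rw [hφ, Finset.mul_sum, Finset.mul_sum, Finset.mul_sum]
        exact Finset.sum_congr rfl fun t _ => by rw [Finset.prod_mul_distrib]; ring
    _ = κ * (∏ i, d i) * if ∀ i j, w i = w j then 1 else 0 := by
        simp_rw [hprod, ← Finset.mul_sum, hsum, mul_assoc]
    _ = _ := by
        rw [Pi.smul_apply, ghzState, smul_eq_mul]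
        split_ifs
        · rw [mul_assoc _ (Real.sqrt 2 : ℂ), mul_inv_cancel₀ sqrt_two_ne_zero]
        · simp

/-! ### Measurement patterns extracting a GHZ state -/

/-- Single-site weights, depending on the target bits `w` at the sites in `V`: sites in `V` are
pinned to the target bit, the measured sites outside the span of `V` are projected onto a
`σ_z` eigenvector, and those inside it onto an eigenvector of `σ_y` or `σ_x`, depending on whether
exactly one of the two neighbours lies in `V`. -/
structure IsGHZPattern (n : ℕ) (V : Finset ℕ) (p : (ℕ → Fin 2) → ℕ → Fin 2 → ℂ) : Prop where
  pinned : ∀ j ∈ V, ∀ w a, p w j a = if a = w j then 1 else 0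
  outer : ∀ j < n, j ∉ V → ((∀ i ∈ V, j < i) ∨ ∀ i ∈ V, i < j) →
    ∃ (d : ℂ) (s : Fin 2), d ≠ 0 ∧ ∀ w a, p w j a = if a = s then d else 0
  inner : ∀ j ∉ V, (∃ i ∈ V, i < j) → (∃ i ∈ V, j < i) →
    ∃ (r : ℕ) (d : ℂ), (Even r ↔ (j - 1 ∈ V ↔ j + 1 ∈ V)) ∧ d ≠ 0 ∧
      ∀ w (a : Fin 2), p w j a = d * Complex.I ^ (r * (a : ℕ))

/-- The matrix linking the GHZ label to the bit of site `j - 1` when the scan has reached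
site `j`: a monomial Clifford matrix just after a pinned site, and a Hadamard matrix dressed with
phase gates otherwise. -/
def IsLinkMatrix (V : Finset ℕ) (j : ℕ) (B : Matrix (Fin 2) (Fin 2) ℂ) : Prop :=
  (j - 1 ∈ V ∧ (j ∈ V → ∀ i ∈ V, i ≤ j) ∧ ∃ (c : ℂ) (p : ℕ) (P : Matrix (Fin 2) (Fin 2) ℂ),
    c ≠ 0 ∧ (P = 1 ∨ P = sigmaX) ∧ B = c • (phaseGate ^ p * P)) ∨
  ((j ∉ V → j - 1 ∉ V) ∧ ∃ (c : ℂ) (p q : ℕ), c ≠ 0 ∧ (Even q ↔ j ∈ V) ∧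
    B = c • (phaseGate ^ p * walsh * phaseGate ^ q))

lemma IsScaledClifford.of_eq_one_or {P : Matrix (Fin 2) (Fin 2) ℂ} (hP : P = 1 ∨ P = sigmaX) :
    IsScaledClifford P := by
  rcases hP with rfl | rfl
  exacts [.one, .sigmaX]

lemma phaseGate_transpose_pow (p : ℕ) : (phaseGate ^ p).transpose = phaseGate ^ p := by
  rw [phaseGate_pow]; ext a b; fin_cases a <;> fin_cases b <;> simp

lemma walsh_transpose : walsh.transpose = walsh := by
  ext a b; fin_cases a <;> fin_cases b <;> simp [walsh]

lemma sigmaX_transpose : sigmaX.transpose = sigmaX := by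
  ext a b; fin_cases a <;> fin_cases b <;> simp [sigmaX]

lemma monomial_mul_walsh {P : Matrix (Fin 2) (Fin 2) ℂ} (hP : P = 1 ∨ P = sigmaX) :
    ∃ q, Even q ∧ P * walsh = walsh * phaseGate ^ q := by
  rcases hP with rfl | rfl
  · exact ⟨0, by simp, by simp⟩
  · exact ⟨2, by decide, sigmaX_mul_walsh⟩

lemma IsLinkMatrix.isScaledClifford_transpose {V : Finset ℕ} {j : ℕ}
    {B : Matrix (Fin 2) (Fin 2) ℂ} (hB : IsLinkMatrix V j B) :
    IsScaledClifford B.transpose := by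
  rcases hB with ⟨-, -, c, p, P, hc, hP, rfl⟩ | ⟨-, c, p, q, hc, -, rfl⟩
  · rw [Matrix.transpose_smul, Matrix.transpose_mul, phaseGate_transpose_pow]
    refine ((IsScaledClifford.of_eq_one_or ?_).mul (.phaseGate_pow p)).smul hc
    rcases hP with rfl | rfl
    exacts [Or.inl Matrix.transpose_one, Or.inr sigmaX_transpose]
  · rw [Matrix.transpose_smul, Matrix.transpose_mul, Matrix.transpose_mul,
      phaseGate_transpose_pow, phaseGate_transpose_pow, walsh_transpose]
    exact ((IsScaledClifford.phaseGate_pow q).mul (.mul .walsh (.phaseGate_pow p))).smul hc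

lemma IsLinkMatrix.isScaledClifford_transpose_mul_walsh {V : Finset ℕ} {j : ℕ}
    {B : Matrix (Fin 2) (Fin 2) ℂ} (hB : IsLinkMatrix V j B) :
    IsScaledClifford (B * walsh).transpose := by
  rw [Matrix.transpose_mul, walsh_transpose]
  exact .mul .walsh hB.isScaledClifford_transpose

/-- Passing a measured site inside the span of `V`. -/
lemma IsLinkMatrix.measure {V : Finset ℕ} {j : ℕ} {B : Matrix (Fin 2) (Fin 2) ℂ}
    (hB : IsLinkMatrix V j B) (hj : j ∉ V) {r : ℕ} (hr : Even r ↔ (j - 1 ∈ V ↔ j + 1 ∈ V))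
    {d : ℂ} (hd : d ≠ 0) :
    IsLinkMatrix V (j + 1) (d • (B * walsh * phaseGate ^ r)) := by
  refine Or.inr ⟨fun _ => by simpa using hj, ?_⟩
  rcases hB with ⟨hj', -, c, p, P, hc, hP, rfl⟩ | ⟨hj', c, p, q, hc, hq, rfl⟩
  · obtain ⟨q, hq, hPq⟩ := monomial_mul_walsh hP
    refine ⟨d * c, p, q + r, mul_ne_zero hd hc, ?_, ?_⟩
    · rw [Nat.even_add]; tauto
    · rw [Matrix.smul_mul, Matrix.smul_mul, smul_smul, Matrix.mul_assoc _ P, hPq, pow_add]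
      simp only [Matrix.mul_assoc]
  · have hj' := hj' hj
    have hq' : ¬ Even q := by tauto
    obtain ⟨e, he, h⟩ := walsh_mul_phaseGate_pow_odd_mul_walsh hq'
    refine ⟨d * c * e, p + 3 * q, 3 * q + r, mul_ne_zero (mul_ne_zero hd hc) he, ?_, ?_⟩
    · have : ¬ Even (3 * q) := by simp [Nat.even_mul, hq', parity_simps]
      rw [Nat.even_add]; tauto
    · rw [Matrix.smul_mul, Matrix.smul_mul, smul_smul,
        show phaseGate ^ p * walsh * phaseGate ^ q * walsh =
          phaseGate ^ p * (walsh * phaseGate ^ q * walsh) by simp only [Matrix.mul_assoc], h,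
        Matrix.mul_smul, Matrix.smul_mul, smul_smul, pow_add, pow_add]
      simp only [Matrix.mul_assoc]

/-- Passing a pinned site other than the first and the last. -/
lemma IsLinkMatrix.pin {V : Finset ℕ} {j : ℕ} {B : Matrix (Fin 2) (Fin 2) ℂ}
    (hB : IsLinkMatrix V j B) (hj : j ∈ V) (hlast : ¬ ∀ i ∈ V, i ≤ j)
    (hnext : j + 1 ∈ V → ∀ i ∈ V, i ≤ j + 1) :
    ∃ B', IsLinkMatrix V (j + 1) B' ∧
      ∀ t a b, (if b = a then 1 else 0) * (B * walsh) t b = (B * walsh) t a * B' t b := by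
  rcases hB with ⟨-, hj', -⟩ | ⟨-, c, p, q, hc, hq, rfl⟩
  · exact absurd (hj' hj) hlast
  · obtain ⟨P, hP, h⟩ := walsh_mul_phaseGate_pow_even_mul_walsh (hq.mpr hj)
    refine ⟨P, Or.inl ⟨by simpa using hj, hnext, 1, 0, P, one_ne_zero, hP, by simp⟩, ?_⟩
    rw [Matrix.smul_mul, show phaseGate ^ p * walsh * phaseGate ^ q * walsh =
      phaseGate ^ p * (walsh * phaseGate ^ q * walsh) by simp only [Matrix.mul_assoc], h,
      phaseGate_pow]
    intro t a b
    rcases hP with rfl | rfl <;> fin_cases t <;> fin_cases a <;> fin_cases b <;>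
      simp [sigmaX]

lemma filter_lt_succ_of_mem {V : Finset ℕ} {j : ℕ} (hj : j ∈ V) :
    V.filter (· < j + 1) = insert j (V.filter (· < j)) := by
  ext i
  simp only [Finset.mem_filter, Finset.mem_insert]
  constructor
  · rintro ⟨hi, h⟩
    rcases Nat.lt_succ_iff_lt_or_eq.mp h with h | rfl
    exacts [Or.inr ⟨hi, h⟩, Or.inl rfl]
  · rintro (rfl | ⟨hi, h⟩)
    exacts [⟨hj, Nat.lt_succ_self _⟩, ⟨hi, by lia⟩]

lemma filter_lt_succ_of_notMem {V : Finset ℕ} {j : ℕ} (hj : j ∉ V) :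
    V.filter (· < j + 1) = V.filter (· < j) := by
  refine Finset.filter_congr fun i hi => ⟨fun h => ?_, fun h => by lia⟩
  exact lt_of_le_of_ne (Nat.lt_succ_iff.mp h) fun e => hj (e ▸ hi)

lemma prod_filter_lt_succ_update {V : Finset ℕ} {j : ℕ} (hj : j ∈ V)
    (A : ℕ → Matrix (Fin 2) (Fin 2) ℂ) (N : Matrix (Fin 2) (Fin 2) ℂ) (w : ℕ → Fin 2)
    (t : Fin 2) :
    ∏ i ∈ V.filter (· < j + 1), Function.update A j N i (w i) t =
      N (w j) t * ∏ i ∈ V.filter (· < j), A i (w i) t := by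
  rw [filter_lt_succ_of_mem hj, Finset.prod_insert (by simp), Function.update_self]
  congr 1
  refine Finset.prod_congr rfl fun i hi => ?_
  rw [Function.update_of_ne (Finset.mem_filter.mp hi).2.ne]

lemma isScaledClifford_update {A : ℕ → Matrix (Fin 2) (Fin 2) ℂ}
    (hA : ∀ i, IsScaledClifford (A i)) {N : Matrix (Fin 2) (Fin 2) ℂ} (hN : IsScaledClifford N)
    (j i : ℕ) : IsScaledClifford (Function.update A j N i) := by
  rw [Function.update_apply]
  split_ifs
  exacts [hN, hA i]

lemma sum_mul_walsh_of_eq {L f : Fin 2 → ℂ} {B : Matrix (Fin 2) (Fin 2) ℂ}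
    (hL : ∀ a, L a = ∑ t, f t * B t a) (b : Fin 2) :
    ∑ a, L a * walsh a b = ∑ t, f t * (B * walsh) t b := by
  simp_rw [hL, Matrix.mul_apply, Finset.sum_mul, Finset.mul_sum]
  rw [Finset.sum_comm]
  simp_rw [mul_assoc]

namespace IsGHZPattern

variable {n : ℕ} {V : Finset ℕ} {p : (ℕ → Fin 2) → ℕ → Fin 2 → ℂ}

lemma chainVec_before (h : IsGHZPattern n V p) {j : ℕ} (hj : j ≤ n) (hV : ∀ i ∈ V, j ≤ i) :
    ∃ (c : ℂ) (s : Fin 2), c ≠ 0 ∧ ∀ w a, chainVec (p w) j a = if a = s then c else 0 := by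
  induction j with
  | zero => exact ⟨1, 0, one_ne_zero, fun w a => rfl⟩
  | succ j ih =>
    obtain ⟨c, s, hc, hcs⟩ := ih (by lia) fun i hi => by have := hV i hi; lia
    obtain ⟨d, s', hd, hds⟩ := h.outer j (by lia) (fun hj => by have := hV j hj; lia)
      (Or.inl hV)
    refine ⟨d * c * walsh s s', s', mul_ne_zero (mul_ne_zero hd hc) ?_, fun w b => ?_⟩
    · rw [walsh_apply]; exact pow_ne_zero _ (by norm_num)
    · simp only [chainVec_succ, hcs, hds, ite_mul, zero_mul, Finset.sum_ite_eq', Finset.mem_univ,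
        if_true]
      split_ifs with e
      · rw [e, mul_assoc]
      · rfl

lemma chainVec_succ_of_mem (h : IsGHZPattern n V p) {j : ℕ} (hj : j ∈ V) (w : ℕ → Fin 2)
    (b : Fin 2) : chainVec (p w) (j + 1) b =
      (if b = w j then 1 else 0) * ∑ a, chainVec (p w) j a * walsh a b := by
  rw [chainVec_succ, h.pinned j hj]

/-- The scan just after the first pinned site. -/
lemma chainVec_first (h : IsGHZPattern n V p) (hVn : V ⊆ Finset.range n) {j : ℕ} (hj : j ∈ V)
    (hfirst : ∀ i ∈ V, j ≤ i) :
    ∃ (N B : Matrix (Fin 2) (Fin 2) ℂ), IsScaledClifford N ∧ IsLinkMatrix V (j + 1) B ∧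
      ∀ w b, chainVec (p w) (j + 1) b = ∑ t, N (w j) t * B t b := by
  obtain ⟨c, s, hc, hcs⟩ := h.chainVec_before (Finset.mem_range.mp (hVn hj)).le hfirst
  have hval (w : ℕ → Fin 2) (b : Fin 2) : chainVec (p w) (j + 1) b =
      (if b = w j then 1 else 0) * (c * walsh s b) := by
    simp only [h.chainVec_succ_of_mem hj, hcs, ite_mul, zero_mul, Finset.sum_ite_eq',
      Finset.mem_univ, if_true]
  have hD (N B : Matrix (Fin 2) (Fin 2) ℂ) (hNB : N * B = c • phaseGate ^ (2 * (s : ℕ)))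
      (w : ℕ → Fin 2) (b : Fin 2) :
      chainVec (p w) (j + 1) b = ∑ t, N (w j) t * B t b := by
    rw [← Matrix.mul_apply, hNB, hval, phaseGate_pow]
    generalize w j = x
    fin_cases s <;> fin_cases x <;> fin_cases b <;> simp [walsh]
  by_cases hnext : j + 1 ∈ V
  · refine ⟨(c * 2⁻¹) • (phaseGate ^ (2 * (s : ℕ)) * walsh), walsh,
      (IsScaledClifford.mul (.phaseGate_pow _) .walsh).smul (mul_ne_zero hc (by norm_num)),
      Or.inr ⟨fun h' => absurd hnext h', 1, 0, 0, one_ne_zero, by simpa using hnext, by simp⟩,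
      hD _ _ ?_⟩
    rw [Matrix.smul_mul, Matrix.mul_assoc, walsh_mul_self, Matrix.mul_smul, smul_smul, mul_one,
      inv_mul_cancel_right₀ two_ne_zero]
  · refine ⟨c • phaseGate ^ (2 * (s : ℕ)), 1, (IsScaledClifford.phaseGate_pow _).smul hc,
      Or.inl ⟨by simpa using hj, fun h' => absurd h' hnext, 1, 0, 1, one_ne_zero, Or.inl rfl,
      by simp⟩, hD _ _ (mul_one _)⟩

lemma chainVec_between (h : IsGHZPattern n V p) (hV : Admissible n V) {j : ℕ}
    (hleft : ∃ i ∈ V, i < j) (hright : ∃ i ∈ V, j ≤ i) :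
    ∃ (A : ℕ → Matrix (Fin 2) (Fin 2) ℂ) (B : Matrix (Fin 2) (Fin 2) ℂ),
      (∀ i, IsScaledClifford (A i)) ∧ IsLinkMatrix V j B ∧
      ∀ w b, chainVec (p w) j b = ∑ t, (∏ i ∈ V.filter (· < j), A i (w i) t) * B t b := by
  induction j with
  | zero => obtain ⟨i, -, hi⟩ := hleft; exact absurd hi (Nat.not_lt_zero i)
  | succ j ih =>
    obtain ⟨k, hk, hjk⟩ := hright
    by_cases hl : ∃ i ∈ V, i < j
    · obtain ⟨A, B, hA, hB, hL⟩ := ih hl ⟨k, hk, by lia⟩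
      by_cases hj : j ∈ V
      · have hnext : j + 1 ∈ V → ∀ i ∈ V, i ≤ j + 1 := fun h' =>
          (hV.2 j hj h').resolve_left fun h'' => by
            obtain ⟨i, hi, hij⟩ := hl
            have := h'' i hi
            lia
        obtain ⟨B', hB', hpin⟩ := hB.pin hj (fun h' => by have := h' k hk; lia) hnext
        refine ⟨Function.update A j (B * walsh).transpose, B', isScaledClifford_update hA
          hB.isScaledClifford_transpose_mul_walsh j, hB', fun w b => ?_⟩
        rw [h.chainVec_succ_of_mem hj, sum_mul_walsh_of_eq (hL w), Finset.mul_sum]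
        refine Finset.sum_congr rfl fun t _ => ?_
        rw [prod_filter_lt_succ_update hj, Matrix.transpose_apply]
        linear_combination (∏ i ∈ V.filter (· < j), A i (w i) t) * hpin t (w j) b
      · obtain ⟨r, d, hr, hd, hp⟩ := h.inner j hj hl ⟨k, hk, by lia⟩
        refine ⟨A, _, hA, hB.measure hj hr hd, fun w b => ?_⟩
        rw [chainVec_succ, hp, sum_mul_walsh_of_eq (hL w), filter_lt_succ_of_notMem hj, Finset.mul_sum]
        refine Finset.sum_congr rfl fun t _ => ?_
        have : (B * walsh * phaseGate ^ r) t b =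
            (B * walsh) t b * Complex.I ^ (r * (b : ℕ)) := by
          rw [Matrix.mul_apply, phaseGate_pow]
          fin_cases b <;> simp
        rw [Matrix.smul_apply, this, smul_eq_mul]
        ring
    · push Not at hl
      have hj : j ∈ V := by
        obtain ⟨i, hi, hij⟩ := hleft
        have := hl i hi
        obtain rfl : i = j := by lia
        exact hi
      obtain ⟨N, B, hN, hB, hL⟩ := h.chainVec_first hV.1 hj hl
      refine ⟨Function.update (fun _ => 1) j N, B,
        isScaledClifford_update (fun _ => .one) hN j, hB, fun w b => ?_⟩
      have hempty : V.filter (· < j) = ∅ :=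
        Finset.filter_false_of_mem fun i hi => (hl i hi).not_gt
      rw [hL]
      refine Finset.sum_congr rfl fun t _ => ?_
      rw [prod_filter_lt_succ_update hj, hempty, Finset.prod_empty, mul_one]

lemma sum_chainVec_mul_walsh_after (h : IsGHZPattern n V p) (hV : Admissible n V)
    (hcard : 2 ≤ V.card) {j : ℕ} (hj : j ≤ n) (hleft : ∀ i ∈ V, i < j) (s : Fin 2) :
    ∃ (A : ℕ → Matrix (Fin 2) (Fin 2) ℂ) (κ : ℂ), (∀ i, IsScaledClifford (A i)) ∧ κ ≠ 0 ∧
      ∀ w, ∑ b, chainVec (p w) j b * walsh b s = κ * ∑ t, ∏ i ∈ V, A i (w i) t := by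
  induction j generalizing s with
  | zero =>
    obtain ⟨i, hi⟩ := Finset.card_pos.mp (by lia : 0 < V.card)
    exact absurd (hleft i hi) (Nat.not_lt_zero i)
  | succ j ih =>
    have hVlt : V.filter (· < j + 1) = V := Finset.filter_true_of_mem hleft
    by_cases hjV : j ∈ V
    · obtain ⟨i, hi, hij⟩ := Finset.exists_mem_ne (by lia : 1 < V.card) j
      have hlt : i < j := lt_of_le_of_ne (Nat.lt_succ_iff.mp (hleft i hi)) hij
      obtain ⟨A, B, hA, hB, hL⟩ := h.chainVec_between hV ⟨i, hi, hlt⟩ ⟨j, hjV, le_rfl⟩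
      refine ⟨Function.update A j (phaseGate ^ (2 * (s : ℕ)) * (B * walsh).transpose), 1,
        isScaledClifford_update hA (.mul (.phaseGate_pow _)
          hB.isScaledClifford_transpose_mul_walsh) j, one_ne_zero, fun w => ?_⟩
      simp only [h.chainVec_succ_of_mem hjV, ite_mul, one_mul, zero_mul, Finset.sum_ite_eq',
        Finset.mem_univ, if_true]
      rw [sum_mul_walsh_of_eq (hL w), Finset.sum_mul]
      refine Finset.sum_congr rfl fun t _ => ?_
      nth_rw 2 [← hVlt]
      rw [prod_filter_lt_succ_update hjV]
      have : (phaseGate ^ (2 * (s : ℕ)) * (B * walsh).transpose) (w j) t =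
          walsh (w j) s * (B * walsh) t (w j) := by
        rw [Matrix.mul_apply, phaseGate_pow]
        generalize w j = x
        fin_cases s <;> fin_cases x <;> simp [walsh]
      rw [this]; ring
    · have hlt : ∀ i ∈ V, i < j := fun i hi =>
        lt_of_le_of_ne (Nat.lt_succ_iff.mp (hleft i hi)) fun e => hjV (e ▸ hi)
      obtain ⟨d, s', hd, hds⟩ := h.outer j (by lia) hjV (Or.inr hlt)
      obtain ⟨A, κ, hA, hκ, hsum⟩ := ih (by lia) hlt s'
      refine ⟨A, d * κ * walsh s' s, hA, mul_ne_zero (mul_ne_zero hd hκ) ?_, fun w => ?_⟩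
      · rw [walsh_apply]; exact pow_ne_zero _ (by norm_num)
      · simp only [chainVec_succ, hds, ite_mul, zero_mul, Finset.sum_ite_eq', Finset.mem_univ, if_true,
          hsum]
        ring

end IsGHZPattern

/-! ### The measurement bases -/

/-- Measure `σ_z` outside the span of `V`; inside it, measure `σ_y` at the sites with exactly one
neighbour in `V` and `σ_x` at all others. -/
def ghzBasis (V : Finset ℕ) (j : ℕ) : PauliBasis :=
  open Classical in
  if (∃ i ∈ V, i < j) ∧ ∃ i ∈ V, j < i then
    if j - 1 ∈ V ↔ j + 1 ∈ V then .x else .y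
  else .z

/-- The single-site weights of the state obtained by projecting the sites outside `V` onto the
vectors `χ j`. -/
def siteWeight (V : Finset ℕ) (χ : ℕ → Fin 2 → ℂ) (w : ℕ → Fin 2) (j : ℕ) (a : Fin 2) : ℂ :=
  if j ∈ V then if a = w j then 1 else 0 else (starRingEnd ℂ) (χ j a)

lemma isGHZPattern_siteWeight {n : ℕ} {V : Finset ℕ} (hV : V ⊆ Finset.range n) {s : ℕ → Fin 2}
    {χ : ℕ → Fin 2 → ℂ} (hχ : ∀ j ∈ Finset.range n \ V, ∑ a : Fin 2, ‖χ j a‖ ^ 2 = 1)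
    (heig : ∀ j ∈ Finset.range n \ V,
      (pauliOf (ghzBasis V j)).mulVec (χ j) = ((-1 : ℂ) ^ (s j : ℕ)) • χ j) :
    IsGHZPattern n V (siteWeight V χ) where
  pinned j hj w a := by rw [siteWeight, if_pos hj]
  outer j hjn hj hout := by
    have hM : j ∈ Finset.range n \ V := by simp [hjn, hj]
    have hb : ghzBasis V j = .z := by
      refine if_neg ?_
      rintro ⟨⟨i, hi, hij⟩, ⟨k, hk, hjk⟩⟩
      rcases hout with h | h
      exacts [(h i hi).not_gt hij, (h k hk).not_gt hjk]
    have he := heig j hM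
    rw [hb] at he
    obtain ⟨d, hd, h⟩ := sigmaZ_eigenvector (hχ j hM) he
    exact ⟨d, s j, hd, fun w a => by rw [siteWeight, if_neg hj, h]⟩
  inner j hj hl hr := by
    have hjn : j < n := by
      obtain ⟨i, hi, hji⟩ := hr
      have := Finset.mem_range.mp (hV hi)
      lia
    have hM : j ∈ Finset.range n \ V := by simp [hjn, hj]
    have he := heig j hM
    by_cases hnb : j - 1 ∈ V ↔ j + 1 ∈ V
    · have hb : ghzBasis V j = .x := by rw [ghzBasis, if_pos ⟨hl, hr⟩, if_pos hnb]
      rw [hb] at he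
      obtain ⟨r, d, hr, hd, h⟩ := sigmaX_eigenvector (hχ j hM) he
      exact ⟨r, d, iff_of_true hr hnb, hd, fun w a => by rw [siteWeight, if_neg hj, h]⟩
    · have hb : ghzBasis V j = .y := by rw [ghzBasis, if_pos ⟨hl, hr⟩, if_neg hnb]
      rw [hb] at he
      obtain ⟨r, d, hr, hd, h⟩ := sigmaY_eigenvector (hχ j hM) he
      exact ⟨r, d, iff_of_false hr hnb, hd, fun w a => by rw [siteWeight, if_neg hj, h]⟩

lemma postMeas_eq_sum_chainVec {n m : ℕ} {V : Finset ℕ} (hV : V ⊆ Finset.range n)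
    (hcard : V.card = m) (χ : ℕ → Fin 2 → ℂ) {w : Fin m → Fin 2} {w' : ℕ → Fin 2}
    (hw : ∀ i, w' (V.orderIsoOfFin hcard i) = w i) :
    postMeas n m (Finset.range n \ V) (fun i => (V.orderIsoOfFin hcard i : ℕ)) χ w =
      ((Real.sqrt 2 : ℂ))⁻¹ ^ n * ∑ b, chainVec (siteWeight V χ w') n b := by
  have key := sum_prod_mul_sign_eq_sum_chainVec (siteWeight V χ w') n fun _ => 1
  simp only [mul_one] at key
  rw [← key, postMeas, Finset.sum_filter, Finset.mul_sum]
  refine Finset.sum_congr rfl fun v _ => ?_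
  have hprod : ∏ j ∈ Finset.range n, siteWeight V χ w' j (bitAt n v j) =
      (∏ j ∈ Finset.range n \ V, (starRingEnd ℂ) (χ j (bitAt n v j))) *
        if ∀ j ∈ V, bitAt n v j = w' j then 1 else 0 := by
    rw [← Finset.prod_sdiff hV]
    congr 1
    · exact Finset.prod_congr rfl fun j hj => if_neg (Finset.mem_sdiff.mp hj).2
    · rw [Finset.prod_congr rfl fun j hj => show siteWeight V χ w' j (bitAt n v j) =
        if bitAt n v j = w' j then 1 else 0 from if_pos hj, Finset.prod_ite_zero]
      simp
  have hiff : (∀ i, bitAt n v (V.orderIsoOfFin hcard i) = w i) ↔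
      ∀ j ∈ V, bitAt n v j = w' j := by
    constructor
    · intro h j hj
      obtain ⟨i, hi⟩ := (V.orderIsoOfFin hcard).surjective ⟨j, hj⟩
      have := h i
      rw [← hw, hi] at this
      exact this
    · exact fun h i => (h _ (V.orderIsoOfFin hcard i).2).trans (hw i)
  rw [hprod]
  simp only [hiff, linCluster]
  split_ifs
  · ring
  · ring

/-- **Complete characterization, positive direction.** For every admissible
`V ⊆ {0,…,n−1}` with `|V| = m ≥ 2` there is a choice of Pauli measurement bases on the
complementary qubits `M` such that, for every outcome string, the post-measurement state
can be turned into the `m`-qubit GHZ state by local Clifford unitaries. -/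
theorem extract_ghz_of_admissible (n m : ℕ) (V : Finset ℕ)
    (hV : Admissible n V) (hcard : V.card = m) (hm : 2 ≤ m)
    (M : Finset ℕ) (hM : M = Finset.range n \ V) :
    ∃ b : ℕ → PauliBasis,
      ∀ (s : ℕ → Fin 2) (χ : ℕ → Fin 2 → ℂ),
        (∀ j ∈ M, ∑ a : Fin 2, ‖χ j a‖ ^ 2 = 1) →
        (∀ j ∈ M, (pauliOf (b j)).mulVec (χ j) = ((-1 : ℂ) ^ (s j : ℕ)) • χ j) →
        ∃ U : Fin m → Matrix (Fin 2) (Fin 2) ℂ,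
          (∀ i : Fin m, IsClifford (U i)) ∧
          ∃ c : ℂ, c ≠ 0 ∧
            localApply m U (postMeas n m M (fun i => (V.orderIsoOfFin hcard i : ℕ)) χ)
              = c • ghzState m := by
  subst hM
  refine ⟨ghzBasis V, fun s χ hχ heig => ?_⟩
  have hpat := isGHZPattern_siteWeight hV.1 hχ heig
  obtain ⟨A, κ, hA, hκ, hsum⟩ := hpat.sum_chainVec_mul_walsh_after hV (by lia) le_rfl
    (fun i hi => Finset.mem_range.mp (hV.1 hi)) 0
  refine exists_localApply_eq_smul_ghzState (by lia) (fun i => A (V.orderIsoOfFin hcard i))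
    (fun i => hA _) (κ := ((Real.sqrt 2 : ℂ))⁻¹ ^ n * κ)
    (mul_ne_zero (pow_ne_zero _ (inv_ne_zero sqrt_two_ne_zero)) hκ) fun w => ?_
  obtain ⟨w', hw⟩ : ∃ w' : ℕ → Fin 2, ∀ i, w' (V.orderIsoOfFin hcard i) = w i := by
    refine ⟨fun j => if hj : j ∈ V then w ((V.orderIsoOfFin hcard).symm ⟨j, hj⟩) else 0,
      fun i => ?_⟩
    beta_reduce
    rw [dif_pos (V.orderIsoOfFin hcard i).2, Subtype.coe_eta, OrderIso.symm_apply_apply]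
  rw [postMeas_eq_sum_chainVec hV.1 hcard χ hw, mul_assoc]
  congr 1
  have h := hsum w'
  simp only [walsh_apply, Fin.val_zero, mul_zero, pow_zero, mul_one] at h
  rw [h]
  congr 1
  refine Finset.sum_congr rfl fun t _ => ?_
  rw [← Finset.prod_coe_sort V, ← (V.orderIsoOfFin hcard).toEquiv.prod_comp]
  exact Finset.prod_congr rfl fun i _ => by rw [← hw i]; rfl

end
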